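/- Let G be a flat, finitely presented group scheme over a scheme B, let f : X → S be a G-morphism, and let Y ⊆ X be a subset of points. If f is smooth (resp. étale) at every point of Y, then f is smooth (resp. étale) on a G-invariant open neighborhood of Y in X, which may moreover be chosen to be quasi-compact if Y is quasi-compact. -/

import Mathlib

open CategoryTheory CategoryTheory.Limits AlgebraicGeometry

noncomputable section

namespace EquivariantSix

universe u

instance (B : Scheme.{u}) : HasFiniteProducts (Over B) :=
  CategoryTheory.Over.ConstructProducts.over_finiteProducts_of_finiteWidePullbacks

/-- A morphism of schemes is flat if all of its stalk maps are flat ring homomorphisms. -/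
def FlatHom {X Y : Scheme.{u}} (f : X ⟶ Y) : Prop :=
  ∀ x : X, RingHom.Flat (f.stalkMap x).hom

/-- A morphism of schemes is of finite presentation if it is locally of finite presentation,
quasi-compact and quasi-separated. -/
def FinPresHom {X Y : Scheme.{u}} (f : X ⟶ Y) : Prop :=
  LocallyOfFinitePresentation f ∧ QuasiCompact f ∧ QuasiSeparated f

/-- A scheme is quasi-compact and quasi-separated. -/
def QCQS (X : Scheme.{u}) : Prop :=
  CompactSpace X ∧ QuasiSeparatedSpace X

/-- A group scheme over a base scheme `B`, i.e. a group object in the category of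
`B`-schemes (with its cartesian monoidal structure given by fibre products over `B`). -/
structure GrpOver (B : Scheme.{u}) where
  carrier : Over B
  mul : carrier ⨯ carrier ⟶ carrier
  one : ⊤_ (Over B) ⟶ carrier
  inv : carrier ⟶ carrier
  mul_assoc : prod.map mul (𝟙 carrier) ≫ mul =
    (prod.associator carrier carrier carrier).hom ≫ prod.map (𝟙 carrier) mul ≫ mul
  one_mul : prod.lift (terminal.from carrier ≫ one) (𝟙 carrier) ≫ mul = 𝟙 carrier
  mul_one : prod.lift (𝟙 carrier) (terminal.from carrier ≫ one) ≫ mul = 𝟙 carrier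
  mul_left_inv : prod.lift inv (𝟙 carrier) ≫ mul = terminal.from carrier ≫ one

/-- The underlying scheme of a group scheme. -/
def GrpOver.sch {B : Scheme.{u}} (G : GrpOver B) : Scheme.{u} := G.carrier.left

/-- The structure morphism of a group scheme. -/
def GrpOver.π {B : Scheme.{u}} (G : GrpOver B) : G.sch ⟶ B := G.carrier.hom

/-- The group scheme `G` over `B` is flat and of finite presentation. -/
def GrpOver.FlatFinPres {B : Scheme.{u}} (G : GrpOver B) : Prop :=
  FlatHom G.π ∧ FinPresHom G.π

variable {B : Scheme.{u}} {G : GrpOver B}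

/-- A `G`-scheme: a `B`-scheme equipped with an action of the group scheme `G`. -/
structure GScheme (B : Scheme.{u}) (G : GrpOver B) where
  carrier : Over B
  act : G.carrier ⨯ carrier ⟶ carrier
  one_act : prod.lift (terminal.from carrier ≫ G.one) (𝟙 carrier) ≫ act = 𝟙 carrier
  mul_act : prod.map G.mul (𝟙 carrier) ≫ act =
    (prod.associator G.carrier G.carrier carrier).hom ≫ prod.map (𝟙 G.carrier) act ≫ act

/-- The underlying scheme of a `G`-scheme. -/
def GScheme.sch (x : GScheme B G) : Scheme.{u} := x.carrier.left

/-- The structure morphism of a `G`-scheme. -/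
def GScheme.str (x : GScheme B G) : x.sch ⟶ B := x.carrier.hom

/-- A `G`-morphism, i.e. a `G`-equivariant morphism of `G`-schemes over `B`. -/
structure GHom (x y : GScheme B G) where
  hom : x.carrier ⟶ y.carrier
  equivariant : x.act ≫ hom = prod.map (𝟙 G.carrier) hom ≫ y.act

/-- The underlying morphism of schemes of a `G`-morphism. -/
def GHom.sch {x y : GScheme B G} (f : GHom x y) : x.sch ⟶ y.sch := f.hom.left

/-- The identity `G`-morphism. -/
def GHom.id (x : GScheme B G) : GHom x x where
  hom := 𝟙 x.carrier
  equivariant := by simp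

/-- Composition of `G`-morphisms. -/
def GHom.comp {x y z : GScheme B G} (f : GHom x y) (g : GHom y z) : GHom x z where
  hom := f.hom ≫ g.hom
  equivariant := by
    rw [← Category.assoc, f.equivariant, Category.assoc, g.equivariant,
      ← Category.assoc, prod.map_map, Category.comp_id]

/-- The object of `Over B` underlying a subscheme `ι : V ⟶ X` of a `G`-scheme `x`. -/
def subOver (x : GScheme B G) {V : Scheme.{u}} (ι : V ⟶ x.sch) : Over B :=
  Over.mk (ι ≫ x.str)

/-- The morphism in `Over B` underlying a subscheme of a `G`-scheme. -/
def subHom (x : GScheme B G) {V : Scheme.{u}} (ι : V ⟶ x.sch) : subOver x ι ⟶ x.carrier :=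
  Over.homMk ι rfl

/-- A subscheme `ι : V ⟶ X` of a `G`-scheme is `G`-invariant if the action
`G ×_B X → X` restricts to a morphism `G ×_B V → V`. -/
def IsInvariantSub (x : GScheme B G) {V : Scheme.{u}} (ι : V ⟶ x.sch) : Prop :=
  ∃ r : (G.carrier ⨯ subOver x ι) ⟶ subOver x ι,
    r ≫ subHom x ι = prod.map (𝟙 G.carrier) (subHom x ι) ≫ x.act

/-- An open subscheme of a `G`-scheme is `G`-invariant if the action restricts to it. -/
def IsInvariantOpen (x : GScheme B G) (U : x.sch.Opens) : Prop :=
  IsInvariantSub x U.ι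

end EquivariantSix

namespace EquivariantSix

universe u

/-- A morphism of schemes is smooth at a point if it is smooth on some open neighborhood. -/
def IsSmoothAt {X Y : Scheme.{u}} (f : X ⟶ Y) (p : X) : Prop :=
  ∃ U : X.Opens, p ∈ U ∧ IsSmooth (U.ι ≫ f)

/-- A morphism of schemes is étale at a point if it is étale on some open neighborhood. -/
def IsEtaleAt {X Y : Scheme.{u}} (f : X ⟶ Y) (p : X) : Prop :=
  ∃ U : X.Opens, p ∈ U ∧ IsEtale (U.ι ≫ f)

section helpers
open TensorProduct

lemma zlt (P : MorphismProperty Scheme.{u}) {Q : ∀ {R S : Type u} [CommRing R] [CommRing S], (R →+* S) → Prop}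
    [HasRingHomProperty P Q] : IsZariskiLocalAtTarget P := inferInstance
lemma zls (P : MorphismProperty Scheme.{u}) {Q : ∀ {R S : Type u} [CommRing R] [CommRing S], (R →+* S) → Prop}
    [HasRingHomProperty P Q] : IsZariskiLocalAtSource P := inferInstance
lemma i2 : IsZariskiLocalAtTarget @LocallyOfFinitePresentation.{u} := zlt _
lemma i3 : IsZariskiLocalAtTarget @Smooth.{u} := zlt _
lemma i4 : IsZariskiLocalAtTarget @Etale.{u} := zlt _
lemma fppfDesc (P : MorphismProperty Scheme.{u}) [P.DescendsAlong (@Surjective ⊓ @Flat ⊓ @QuasiCompact)]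
    [IsZariskiLocalAtTarget P] :
    P.DescendsAlong (@Surjective ⊓ @Flat ⊓ @LocallyOfFinitePresentation) := inferInstance
lemma i5 : MorphismProperty.DescendsAlong (C := Scheme.{u}) (@LocallyOfFinitePresentation)
      (@Surjective ⊓ @Flat ⊓ @LocallyOfFinitePresentation) := by
  have := i2
  exact fppfDesc _

lemma isPullback_of_mono_post {C : Type*} [Category C] {P X Y Z W : C} {p : P ⟶ X} {q : P ⟶ Y}
    {f : X ⟶ Z} {g : Y ⟶ Z} (i : Z ⟶ W) [Mono i] (H : IsPullback p q (f ≫ i) (g ≫ i)) :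
    IsPullback p q f g := by
  have w : p ≫ f = q ≫ g := by
    rw [← cancel_mono i]; simpa using H.w
  refine ⟨⟨w⟩, ⟨PullbackCone.IsLimit.mk w (fun s => H.lift s.fst s.snd ?_) ?_ ?_ ?_⟩⟩
  · simp [s.condition_assoc]
  · intro s; simp
  · intro s; simp
  · intro s m h1 h2
    apply H.hom_ext <;> simp [h1, h2]

lemma of_comp_opens {P : MorphismProperty Scheme.{u}} [P.IsStableUnderBaseChange]
    {X Y Z : Scheme.{u}} (q : X ⟶ Y) (i : Y ⟶ Z) [Mono i] (h : P (q ≫ i)) : P q := by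
  have H : IsPullback (𝟙 X) q (q ≫ i) i := by
    refine ⟨⟨by simp⟩, ⟨PullbackCone.IsLimit.mk _ (fun s => s.fst) ?_ ?_ ?_⟩⟩
    · intro s; simp
    · intro s
      rw [← cancel_mono i]; simpa using s.condition
    · intro s m h1 h2
      simpa using h1
  exact P.of_isPullback H h

lemma lemma2 {X X0 O O0 : Scheme.{u}} {p : O ⟶ X} {g' : O ⟶ O0} {g : X ⟶ X0} {q : O0 ⟶ X0}
    (H : IsPullback p g' g q) [Flat q] [LocallyOfFinitePresentation q]
    [LocallyOfFinitePresentation g'] [Surjective p] : LocallyOfFinitePresentation g := by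
  let D : X0.Opens := ⟨Set.range q, q.isOpenMap.isOpen_range⟩
  have hq : Set.range q ⊆ Set.range D.ι := by simp [D]
  have hg : Set.range g ⊆ Set.range D.ι := by
    rintro _ ⟨x, rfl⟩
    obtain ⟨y, rfl⟩ := p.surjective x
    rw [← Scheme.Hom.comp_apply, H.w, Scheme.Hom.comp_apply]
    exact hq ⟨_, rfl⟩
  let q1 := IsOpenImmersion.lift D.ι q hq
  let g1 := IsOpenImmersion.lift D.ι g hg
  have eq : q1 ≫ D.ι = q := IsOpenImmersion.lift_fac _ _ _
  have eg : g1 ≫ D.ι = g := IsOpenImmersion.lift_fac _ _ _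
  have H1 : IsPullback p g' g1 q1 := by
    refine isPullback_of_mono_post D.ι ?_
    rwa [eq, eg]
  have : Flat q1 := of_comp_opens (P := @Flat) q1 D.ι (by rwa [eq])
  have : LocallyOfFinitePresentation q1 :=
    of_comp_opens (P := @LocallyOfFinitePresentation) q1 D.ι (by rwa [eq])
  have : Surjective q1 := by
    refine ⟨fun x => ?_⟩
    obtain ⟨y, hy⟩ : D.ι x ∈ Set.range q := x.2
    refine ⟨y, D.ι.isOpenEmbedding.injective ?_⟩
    rw [← hy, ← Scheme.Hom.comp_apply, eq]
  have := i5.{u}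
  have : LocallyOfFinitePresentation g1 :=
    MorphismProperty.of_isPullback_of_descendsAlong (P := @LocallyOfFinitePresentation) (Q := @Surjective ⊓ @Flat ⊓ @LocallyOfFinitePresentation)
     H1.flip ⟨⟨inferInstance, inferInstance⟩, inferInstance⟩ ‹_›
  rw [← eg]
  infer_instance

lemma lemma2_ring {B0 B C0 C : Type u} [CommRing B0] [CommRing B] [CommRing C0] [CommRing C]
   [Algebra B0 B] [Algebra B0 C0] [Algebra C0 C] [Algebra B C] [Algebra B0 C]
   [IsScalarTower B0 B C] [IsScalarTower B0 C0 C] [Algebra.IsPushout B0 C0 B C]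
   [Module.Flat B0 C0] [Algebra.FinitePresentation B0 C0] [Algebra.FinitePresentation C0 C]
   (hs : Function.Surjective (PrimeSpectrum.comap (algebraMap B C))) :
   Algebra.FinitePresentation B0 B := by
  have H := isPullback_SpecMap_of_isPushout _ _ _ _ (CommRingCat.isPushout_of_isPushout B0 C0 B C)
  have h1 : Flat (Spec.map (CommRingCat.ofHom (algebraMap B0 C0))) := by
    rw [HasRingHomProperty.Spec_iff (P := @Flat)]
    simpa [RingHom.flat_algebraMap_iff]
  have h2 : LocallyOfFinitePresentation (Spec.map (CommRingCat.ofHom (algebraMap B0 C0))) := by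
    rw [HasRingHomProperty.Spec_iff (P := @LocallyOfFinitePresentation)]
    simpa [RingHom.finitePresentation_algebraMap]
  have h3 : LocallyOfFinitePresentation (Spec.map (CommRingCat.ofHom (algebraMap C0 C))) := by
    rw [HasRingHomProperty.Spec_iff (P := @LocallyOfFinitePresentation)]
    simpa [RingHom.finitePresentation_algebraMap]
  have h4 : Surjective (Spec.map (CommRingCat.ofHom (algebraMap B C))) := ⟨hs⟩
  have := lemma2 H.flip
  rw [HasRingHomProperty.Spec_iff (P := @LocallyOfFinitePresentation)] at this
  simpa [RingHom.finitePresentation_algebraMap] using this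

section
attribute [local instance] Algebra.TensorProduct.rightAlgebra
variable {A B A' C : Type u} [CommRing A] [CommRing B] [CommRing A'] [CommRing C]
  [Algebra A B] [Algebra A A'] [Algebra B C] [Algebra A' C] [Algebra (A' ⊗[A] B) C]
  [IsScalarTower B (A' ⊗[A] B) C] [IsScalarTower A' (A' ⊗[A] B) C]
  [Module.Flat A A'] 

lemma aux_h1 (h : A' ⊗[A] B) [IsLocalization.Away h C] [Module.FaithfullyFlat B C]
    [Subsingleton (Algebra.H1Cotangent A' C)] : Subsingleton (Algebra.H1Cotangent A B) := by
  let M := Algebra.H1Cotangent A B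
  let E := A' ⊗[A] B
  let φ : E ⊗[B] M →ₗ[E] Algebra.H1Cotangent A' E :=
    LinearMap.liftBaseChange E (Algebra.H1Cotangent.map A A' B E)
  have hφ : Function.Bijective φ := by
    have key : ∀ z : A' ⊗[A] M, φ ((Algebra.IsPushout.cancelBaseChange A A' B E M).symm z) =
        Algebra.tensorH1CotangentOfFlat A B A' z := by
      intro z
      induction z with
      | zero => simp
      | add x y hx hy => simp only [map_add, hx, hy]
      | tmul s m =>
        rw [Algebra.IsPushout.cancelBaseChange_symm_tmul, Algebra.tensorH1CotangentOfFlat_tmul]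
        simp only [φ, LinearMap.liftBaseChange_tmul, algebraMap_smul]
        rfl
    have : (φ : _ → _) = Algebra.tensorH1CotangentOfFlat A B A' ∘ (Algebra.IsPushout.cancelBaseChange A A' B E M) := by
      funext z
      obtain ⟨z, rfl⟩ := (Algebra.IsPushout.cancelBaseChange A A' B E M).symm.surjective z
      simp [key]
    rw [this]
    exact (LinearEquiv.bijective _).comp (LinearEquiv.bijective _)
  let e := LinearEquiv.ofBijective φ hφ
  have h1 : Subsingleton (C ⊗[E] Algebra.H1Cotangent A' E) :=
    (Algebra.tensorH1CotangentOfIsLocalization A' C (.powers h)).subsingleton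
  have h2 : Subsingleton (C ⊗[E] (E ⊗[B] M)) :=
    (LinearEquiv.lTensor C e).subsingleton
  have h3 : Subsingleton (C ⊗[B] M) :=
    (TensorProduct.AlgebraTensorModule.cancelBaseChange B E E C M).symm.subsingleton
  exact Module.FaithfullyFlat.lTensor_reflects_triviality B C M

def aux_omega (h : A' ⊗[A] B) [IsLocalization.Away h C] :
    C ⊗[B] Ω[B⁄A] ≃ₗ[A' ⊗[A] B] Ω[C⁄A'] := by
  let E := A' ⊗[A] B
  have : Algebra.FormallyEtale E C := .of_isLocalization (.powers h)
  let e : E ⊗[B] Ω[B⁄A] ≃ₗ[E] Ω[E⁄A'] := KaehlerDifferential.tensorKaehlerEquiv A A' B E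
  exact (TensorProduct.AlgebraTensorModule.cancelBaseChange B E E C Ω[B⁄A]).symm ≪≫ₗ
    (LinearEquiv.lTensor C e) ≪≫ₗ 
    (KaehlerDifferential.tensorKaehlerEquivOfFormallyEtale A' E C).restrictScalars E
end

section
attribute [local instance] Algebra.TensorProduct.rightAlgebra MvPolynomial.algebraMvPolynomial
set_option linter.unusedSectionVars false
variable {A B A' C : Type u} [CommRing A] [CommRing B] [CommRing A'] [CommRing C]
  [Algebra A B] [Algebra A A'] [Algebra B C] [Algebra A' C] [Algebra (A' ⊗[A] B) C]
  [IsScalarTower B (A' ⊗[A] B) C] [IsScalarTower A' (A' ⊗[A] B) C]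
  [Module.Flat A A'] [Algebra.FinitePresentation A A']

lemma exists_lift (h : A' ⊗[A] B) : ∃ (s : Finset B) (h0 : MvPolynomial s A'),
    MvPolynomial.aeval (fun b : s => (1 : A') ⊗ₜ[A] (b : B)) h0 = h := by
  have hsurj : Function.Surjective (MvPolynomial.aeval (R := A') (fun b : B => (1 : A') ⊗ₜ[A] b)) := by
    intro z
    induction z with
    | zero => exact ⟨0, by simp⟩
    | add x y hx hy =>
      obtain ⟨x, rfl⟩ := hx
      obtain ⟨y, rfl⟩ := hy
      exact ⟨x + y, by simp⟩
    | tmul a b => exact ⟨MvPolynomial.C a * MvPolynomial.X b, by simp [Algebra.TensorProduct.algebraMap_apply]⟩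
  obtain ⟨p, rfl⟩ := hsurj h
  obtain ⟨s, q, rfl⟩ := MvPolynomial.exists_finset_rename p
  exact ⟨s, q, by simp [MvPolynomial.aeval_rename]; rfl⟩

lemma aux_fp (h : A' ⊗[A] B) [IsLocalization.Away h C] [Algebra.FinitePresentation A' C]
   (hs : Function.Surjective (PrimeSpectrum.comap (algebraMap B C))) :
    Algebra.FinitePresentation A B := by
  obtain ⟨s, h0, hh⟩ := exists_lift h
  let B0 := MvPolynomial s A
  let E0 := MvPolynomial s A'
  let E := A' ⊗[A] B
  let C0 := Localization.Away h0
  let : Algebra B0 B := (MvPolynomial.aeval (fun b : s => (b : B))).toAlgebra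
  let : Algebra E0 E := (MvPolynomial.aeval (fun b : s => (1 : A') ⊗ₜ[A] (b : B))).toAlgebra
  have : IsScalarTower A B0 B := IsScalarTower.of_algebraMap_eq fun a => by
    exact ((MvPolynomial.aeval (R := A) (fun b : s => (b : B))).commutes a).symm
  have : IsScalarTower A' E0 E := IsScalarTower.of_algebraMap_eq fun a => by
    exact ((MvPolynomial.aeval (R := A') (fun b : s => (1 : A') ⊗ₜ[A] (b : B))).commutes a).symm
  let : Algebra B0 E := ((algebraMap B E).comp (algebraMap B0 B)).toAlgebra
  have : IsScalarTower B0 B E := .of_algebraMap_eq fun _ => rfl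
  have hc : (algebraMap B E).comp (algebraMap B0 B) = (algebraMap E0 E).comp (algebraMap B0 E0) := by
    apply MvPolynomial.ringHom_ext
    · intro a
      have h1 : algebraMap B0 B (MvPolynomial.C a) = algebraMap A B a :=
        (MvPolynomial.aeval (R := A) (fun b : s => (b : B))).commutes a
      have h2 : algebraMap B0 E0 (MvPolynomial.C a) = MvPolynomial.C (algebraMap A A' a) :=
        MvPolynomial.map_C _ _
      have h3 : algebraMap E0 E (MvPolynomial.C (algebraMap A A' a)) = algebraMap A' E (algebraMap A A' a) :=
        (MvPolynomial.aeval (R := A') (fun b : s => (1 : A') ⊗ₜ[A] (b : B))).commutes _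
      rw [RingHom.comp_apply, RingHom.comp_apply, h1, h2, h3, ← IsScalarTower.algebraMap_apply,
        ← IsScalarTower.algebraMap_apply]
    · intro b
      have h1 : algebraMap B0 B (MvPolynomial.X b) = b := MvPolynomial.aeval_X _ _
      have h2 : algebraMap B0 E0 (MvPolynomial.X b) = MvPolynomial.X b := MvPolynomial.map_X _ _
      have h3 : algebraMap E0 E (MvPolynomial.X b) = (1 : A') ⊗ₜ[A] (b : B) := MvPolynomial.aeval_X _ _
      rw [RingHom.comp_apply, RingHom.comp_apply, h1, h2, h3]
      rfl
  have : IsScalarTower B0 E0 E := .of_algebraMap_eq fun z => congr($hc z)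
  have : Algebra.IsPushout A A' B0 E0 := inferInstance
  have : Algebra.IsPushout A B0 A' E0 := inferInstance
  have hP : Algebra.IsPushout A B A' E := inferInstance
  have : IsScalarTower A B0 E := .of_algebraMap_eq fun z => by
    rw [IsScalarTower.algebraMap_apply B0 B E, ← IsScalarTower.algebraMap_apply A B0 B,
      ← IsScalarTower.algebraMap_apply]
  have : IsScalarTower A E0 E := .of_algebraMap_eq fun z => by
    rw [IsScalarTower.algebraMap_apply A A' E0, ← IsScalarTower.algebraMap_apply A' E0 E,
      ← IsScalarTower.algebraMap_apply]
  have hBE : Algebra.IsPushout B0 B E0 E := (Algebra.IsPushout.comp_iff A B0 A' E0).mp hP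
  let : Algebra E0 C := ((algebraMap E C).comp (algebraMap E0 E)).toAlgebra
  have : IsScalarTower E0 E C := .of_algebraMap_eq fun _ => rfl
  have hu : IsUnit (algebraMap E0 C h0) := by
    rw [IsScalarTower.algebraMap_apply E0 E C]
    have : algebraMap E0 E h0 = h := hh
    rw [this]
    exact IsLocalization.Away.algebraMap_isUnit h
  let : Algebra C0 C := (IsLocalization.Away.lift (S := C0) h0 hu).toAlgebra
  have : IsScalarTower E0 C0 C := .of_algebraMap_eq fun z => by
    exact (IsLocalization.Away.lift_eq (S := C0) h0 hu z).symm
  have : IsLocalization (Algebra.algebraMapSubmonoid E (.powers h0)) C := by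
    have : Algebra.algebraMapSubmonoid E (.powers h0) = .powers h := by
      rw [Algebra.algebraMapSubmonoid_powers, ← hh]; rfl
    rw [this]
    infer_instance
  have hEC : Algebra.IsPushout E0 E C0 C := Algebra.isPushout_of_isLocalization (.powers h0) C0 E C
  let : Algebra B0 C := ((algebraMap E0 C).comp (algebraMap B0 E0)).toAlgebra
  have : IsScalarTower B0 E0 C := .of_algebraMap_eq fun _ => rfl
  have : IsScalarTower B0 E C := .of_algebraMap_eq fun z => by
    rw [IsScalarTower.algebraMap_apply B0 E0 C, IsScalarTower.algebraMap_apply B0 E0 E,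
      IsScalarTower.algebraMap_apply E0 E C]
  have : IsScalarTower B0 B C := .of_algebraMap_eq fun z => by
    rw [IsScalarTower.algebraMap_apply B0 E C, IsScalarTower.algebraMap_apply B0 B E,
      IsScalarTower.algebraMap_apply B E C]
  have : IsScalarTower B0 C0 C := .of_algebraMap_eq fun z => by
    rw [IsScalarTower.algebraMap_apply B0 E0 C, IsScalarTower.algebraMap_apply B0 E0 C0,
      IsScalarTower.algebraMap_apply E0 C0 C]
  have : Algebra.IsPushout B0 C0 B C := by
    have := hBE.symm
    have := hEC.symm
    exact (Algebra.IsPushout.comp_iff B0 E0 B E).mpr this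
  have : IsScalarTower A' E0 C := .of_algebraMap_eq fun z => by
    rw [IsScalarTower.algebraMap_apply E0 E C, ← IsScalarTower.algebraMap_apply A' E0 E,
      ← IsScalarTower.algebraMap_apply A' E C]
  have : IsScalarTower A' C0 C := .of_algebraMap_eq fun z => by
    rw [IsScalarTower.algebraMap_apply A' E0 C, IsScalarTower.algebraMap_apply A' E0 C0,
      IsScalarTower.algebraMap_apply E0 C0 C]
  have : Algebra.FinitePresentation B0 E0 := .equiv (Algebra.IsPushout.equiv A B0 A' E0)
  have : Module.Flat B0 E0 := .of_linearEquiv (Algebra.IsPushout.equiv A B0 A' E0).symm.toLinearEquiv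
  have : Module.Flat E0 C0 := IsLocalization.flat _ (.powers h0)
  have : Module.Flat B0 C0 := .trans B0 E0 C0
  have : Algebra.FinitePresentation E0 C0 := IsLocalization.Away.finitePresentation h0
  have : Algebra.FinitePresentation B0 C0 := .trans B0 E0 C0
  have : Algebra.FinitePresentation A' C0 := .trans A' E0 C0
  have : Algebra.FinitePresentation C0 C := Algebra.FinitePresentation.of_restrict_scalars_finitePresentation A' C0 C
  have : Algebra.FinitePresentation B0 B := lemma2_ring (C0 := C0) (C := C) hs
  exact .trans A B0 B

lemma aux_ff (h : A' ⊗[A] B) [IsLocalization.Away h C]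
   (hs : Function.Surjective (PrimeSpectrum.comap (algebraMap B C))) :
    Module.FaithfullyFlat B C := by
  have : Module.Flat B (A' ⊗[A] B) := Module.Flat.of_linearEquiv
    (Algebra.IsPushout.equiv A B A' (A' ⊗[A] B)).symm.toLinearEquiv
  have : Module.Flat (A' ⊗[A] B) C := IsLocalization.flat _ (.powers h)
  have : Module.Flat B C := .trans B (A' ⊗[A] B) C
  exact .of_comap_surjective hs

lemma aux_smooth (h : A' ⊗[A] B) [IsLocalization.Away h C] [Algebra.Smooth A' C]
   (hs : Function.Surjective (PrimeSpectrum.comap (algebraMap B C))) :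
    Algebra.Smooth A B := by
  have : Algebra.FinitePresentation A B := aux_fp (C := C) h hs
  have := aux_ff (C := C) h hs
  refine ⟨?_, inferInstance⟩
  rw [Algebra.formallySmooth_iff]
  constructor
  · let e := aux_omega (C := C) h
    have : Module.Flat C (C ⊗[B] Ω[B⁄A]) := .of_linearEquiv
      (LinearEquiv.extendScalarsOfIsLocalization (.powers h) C e)
    have : Module.Flat B Ω[B⁄A] := Module.Flat.of_flat_tensorProduct _ _ C
    exact Module.Flat.projective_of_finitePresentation
  · exact aux_h1 (C := C) h

lemma aux_etale (h : A' ⊗[A] B) [IsLocalization.Away h C] [Algebra.Etale A' C]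
   (hs : Function.Surjective (PrimeSpectrum.comap (algebraMap B C))) :
    Algebra.Etale A B := by
  rw [Algebra.Etale.iff_formallyUnramified_and_smooth]
  refine ⟨⟨?_⟩, aux_smooth (C := C) h hs⟩
  have := aux_ff (C := C) h hs
  have : Subsingleton (C ⊗[B] Ω[B⁄A]) := (aux_omega (C := C) h).subsingleton
  exact Module.FaithfullyFlat.lTensor_reflects_triviality B C _
end


section
attribute [local instance] Algebra.TensorProduct.rightAlgebra

def DescAff (P : MorphismProperty Scheme.{u}) : Prop :=
  ∀ (A B A' : Type u) [CommRing A] [CommRing B] [CommRing A'] [Algebra A B] [Algebra A A']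
    [Module.Flat A A'] [Algebra.FinitePresentation A A'] (h : A' ⊗[A] B),
    P (Spec.map (CommRingCat.ofHom (algebraMap A' (Localization.Away h)))) →
    Surjective (Spec.map (CommRingCat.ofHom (algebraMap B (Localization.Away h)))) →
    P (Spec.map (CommRingCat.ofHom (algebraMap A B)))

lemma descAff_smooth : DescAff.{u} @Smooth := by
  intro A B A' _ _ _ _ _ _ _ h h1 h2
  rw [HasRingHomProperty.Spec_iff (P := @Smooth)] at h1 ⊢
  simp only [CommRingCat.hom_ofHom, RingHom.smooth_algebraMap] at h1 ⊢
  exact aux_smooth (C := Localization.Away h) h h2.surj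

lemma descAff_etale : DescAff.{u} @Etale := by
  intro A B A' _ _ _ _ _ _ _ h h1 h2
  rw [HasRingHomProperty.Spec_iff (P := @Etale)] at h1 ⊢
  simp only [CommRingCat.hom_ofHom, RingHom.etale_algebraMap] at h1 ⊢
  exact aux_etale (C := Localization.Away h) h h2.surj

variable {P : MorphismProperty Scheme.{u}} 

lemma lemB1 (hP : DescAff P) [IsZariskiLocalAtSource P]
    (A B A' : Type u) [CommRing A] [CommRing B] [CommRing A'] [Algebra A B] [Algebra A A']
    [Module.Flat A A'] [Algebra.FinitePresentation A A']
    (O : (Spec (.of (A' ⊗[A] B))).Opens)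
    (hO : P (O.ι ≫ Spec.map (CommRingCat.ofHom (algebraMap A' (A' ⊗[A] B)))))
    (p : Spec (.of (A' ⊗[A] B))) (hp : p ∈ O) :
    ∃ b : B, Spec.map (CommRingCat.ofHom (algebraMap B (A' ⊗[A] B))) p ∈ PrimeSpectrum.basicOpen b ∧
      P (Spec.map (CommRingCat.ofHom (algebraMap A (Localization.Away b)))) := by
  let E := A' ⊗[A] B
  let π := Spec.map (CommRingCat.ofHom (algebraMap B E))
  have : Module.Flat B E := Module.Flat.of_linearEquiv
    (Algebra.IsPushout.equiv A B A' (A' ⊗[A] B)).symm.toLinearEquiv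
  have : Algebra.FinitePresentation B E := .equiv (Algebra.IsPushout.equiv A B A' E)
  have h1 : Flat π := by
    rw [HasRingHomProperty.Spec_iff (P := @Flat)]
    simpa [RingHom.flat_algebraMap_iff]
  have h2 : LocallyOfFinitePresentation π := by
    rw [HasRingHomProperty.Spec_iff (P := @LocallyOfFinitePresentation)]
    simpa [RingHom.finitePresentation_algebraMap]
  obtain ⟨_, ⟨_, ⟨h, rfl⟩, rfl⟩, hph, hhO⟩ :=
    PrimeSpectrum.isBasis_basic_opens.exists_subset_of_mem_open (a := p) hp O.2
  let D : (Spec (.of E)).Opens := PrimeSpectrum.basicOpen h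
  have hopen : IsOpen (π '' (D : Set (Spec (.of E)))) := π.isOpenMap _ D.2
  have hπp : π p ∈ π '' (D : Set (Spec (.of E))) := ⟨p, hph, rfl⟩
  obtain ⟨_, ⟨_, ⟨b, rfl⟩, rfl⟩, hpb, hb⟩ :=
    PrimeSpectrum.isBasis_basic_opens.exists_subset_of_mem_open (a := π p) hπp hopen
  refine ⟨b, hpb, ?_⟩
  let B1 := Localization.Away b
  let E1 := A' ⊗[A] B1
  let ψ : E →ₐ[A'] E1 := Algebra.TensorProduct.map (AlgHom.id A' A') (IsScalarTower.toAlgHom A B B1)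
  let : Algebra E E1 := ψ.toAlgebra
  have t1 : IsScalarTower A' E E1 := .of_algebraMap_eq fun z => (ψ.commutes z).symm
  let : Algebra B E1 := ((algebraMap B1 E1).comp (algebraMap B B1)).toAlgebra
  have t0 : IsScalarTower B B1 E1 := .of_algebraMap_eq fun z => rfl
  have t2 : IsScalarTower B E E1 := .of_algebraMap_eq fun z => by
    change (1 : A') ⊗ₜ[A] (algebraMap B B1 z) = ψ ((1 : A') ⊗ₜ[A] z)
    exact (Algebra.TensorProduct.map_tmul (AlgHom.id A' A') (IsScalarTower.toAlgHom A B B1) 1 z).symm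
  have t3 : IsScalarTower A E E1 := .of_algebraMap_eq fun z => by
    rw [IsScalarTower.algebraMap_apply A A' E, ← IsScalarTower.algebraMap_apply A' E E1,
      ← IsScalarTower.algebraMap_apply]
  have t4 : IsScalarTower A B E1 := .of_algebraMap_eq fun z => by
    rw [IsScalarTower.algebraMap_apply B B1 E1, ← IsScalarTower.algebraMap_apply A B B1,
      ← IsScalarTower.algebraMap_apply]
  have hPO0 : Algebra.IsPushout A B1 A' E1 := inferInstance
  have hPO : Algebra.IsPushout B B1 E E1 :=
    (Algebra.IsPushout.comp_iff A B A' E).mp hPO0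
  have H := isPullback_SpecMap_of_isPushout _ _ _ _ (CommRingCat.isPushout_of_isPushout B B1 E E1)
  let h1 : E1 := ψ h
  let C := Localization.Away h1
  refine hP A B1 A' h1 ?_ ?_
  · let i : Spec (.of E1) ⟶ Spec (.of E) := Spec.map (CommRingCat.ofHom (algebraMap E E1))
    have hi : IsOpenImmersion i := 
      MorphismProperty.of_isPullback (P := @IsOpenImmersion) H inferInstance
    let j0 : Spec (.of C) ⟶ Spec (.of E1) := Spec.map (CommRingCat.ofHom (algebraMap E1 C))
    let j := j0 ≫ i
    have hj : Set.range j ⊆ Set.range O.ι := by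
      rintro _ ⟨w, rfl⟩
      rw [Scheme.Opens.range_ι]
      apply hhO
      have hw : j0 w ∈ PrimeSpectrum.basicOpen h1 := by
        have : j0 w ∈ j0.opensRange := ⟨w, rfl⟩
        rwa [Scheme.Hom.opensRange_localizationAway (R := .of E1) h1] at this
      exact hw
    let k := IsOpenImmersion.lift O.ι j hj
    have hk : k ≫ O.ι = j := IsOpenImmersion.lift_fac _ _ _
    have : IsOpenImmersion (k ≫ O.ι) := by rw [hk]; infer_instance
    have : IsOpenImmersion k := IsOpenImmersion.of_comp k O.ι
    have := IsZariskiLocalAtSource.comp hO k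
    rw [reassoc_of% hk] at this
    convert! this using 1
    simp only [j, j0, i, Category.assoc, ← Spec.map_comp, ← CommRingCat.ofHom_comp]
    congr 2
    ext z
    change algebraMap A' C z = algebraMap E1 C (algebraMap E E1 (algebraMap A' E z))
    rw [← IsScalarTower.algebraMap_apply A' E E1, ← IsScalarTower.algebraMap_apply A' E1 C]
  · refine ⟨fun y => ?_⟩
    let C' := Localization.Away h1
    let y0 : Spec (.of B) := Spec.map (CommRingCat.ofHom (algebraMap B B1)) y
    have hy0 : y0 ∈ PrimeSpectrum.basicOpen b := by
      rw [← Scheme.Hom.opensRange_localizationAway (R := .of B) b]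
      exact ⟨y, rfl⟩
    obtain ⟨z, hz, hzy⟩ := hb hy0
    obtain ⟨w, hw1, hw2⟩ := Scheme.exists_preimage_of_isPullback H y z hzy.symm
    have hw : w ∈ PrimeSpectrum.basicOpen h1 := by
      change h1 ∉ w.asIdeal
      have : h ∉ z.asIdeal := hz
      rw [← hw2] at this
      exact this
    rw [← Scheme.Hom.opensRange_localizationAway (R := .of E1) h1] at hw
    obtain ⟨v, hv⟩ := hw
    refine ⟨v, ?_⟩
    rw [← hw1, ← hv, IsScalarTower.algebraMap_eq B1 E1 (Localization.Away h1), CommRingCat.ofHom_comp, Spec.map_comp]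
    rfl
end


lemma pbMap {Z0 X0 Y0 S0 Z X Y S : Scheme.{u}} {a0 : Z0 ⟶ X0} {b0 : Z0 ⟶ Y0} {c0 : X0 ⟶ S0} {d0 : Y0 ⟶ S0}
    {a : Z ⟶ X} {b : Z ⟶ Y} {c : X ⟶ S} {d : Y ⟶ S} (H0 : IsPullback a0 b0 c0 d0)
    (H : IsPullback a b c d) (i₁ : X0 ⟶ X) (i₂ : Y0 ⟶ Y) (i₃ : S0 ⟶ S)
    [IsOpenImmersion i₁] [IsOpenImmersion i₂] [Mono i₃]
    (e₁ : c0 ≫ i₃ = i₁ ≫ c) (e₂ : d0 ≫ i₃ = i₂ ≫ d) :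
    ∃ m : Z0 ⟶ Z, IsOpenImmersion m ∧ m ≫ a = a0 ≫ i₁ ∧ m ≫ b = b0 ≫ i₂ ∧
      ∀ p, a p ∈ Set.range i₁ → b p ∈ Set.range i₂ → p ∈ Set.range m := by
  refine ⟨H0.isoPullback.hom ≫ pullback.map c0 d0 c d i₁ i₂ i₃ e₁ e₂ ≫ H.isoPullback.inv,
    inferInstance, ?_, ?_, ?_⟩
  · rw [Category.assoc, Category.assoc, H.isoPullback_inv_fst]
    erw [pullback.lift_fst]
    rw [← Category.assoc, H0.isoPullback_hom_fst]
  · rw [Category.assoc, Category.assoc, H.isoPullback_inv_snd]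
    erw [pullback.lift_snd]
    rw [← Category.assoc, H0.isoPullback_hom_snd]
  intro p h1 h2
  have : H.isoPullback.hom p ∈ Set.range (pullback.map c0 d0 c d i₁ i₂ i₃ e₁ e₂) := by
    rw [Scheme.Pullback.range_map]
    constructor
    · simpa [← Scheme.Hom.comp_apply] using h1
    · simpa [← Scheme.Hom.comp_apply] using h2
  obtain ⟨q, hq⟩ := this
  refine ⟨H0.isoPullback.inv q, ?_⟩
  have e : H.isoPullback.inv (H.isoPullback.hom p) = p := by
    simp [← Scheme.Hom.comp_apply]
  rw [← e, ← hq, ← Scheme.Hom.comp_apply, ← Scheme.Hom.comp_apply]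
  simp only [Iso.inv_hom_id_assoc]

section
attribute [local instance] Algebra.TensorProduct.rightAlgebra
variable {P : MorphismProperty Scheme.{u}} 

lemma lemB2 (hP : DescAff P) [IsZariskiLocalAtSource P] [P.IsStableUnderBaseChange]
    [P.IsMultiplicative] {X' X S' S : Scheme.{u}} {π : X' ⟶ X} {f' : X' ⟶ S'} {f : X ⟶ S} {s : S' ⟶ S}
    (H : IsPullback π f' f s) [Flat s] [LocallyOfFinitePresentation s] (O : X'.Opens)
    (hO : P (O.ι ≫ f')) (p : X') (hp : p ∈ O) :
    ∃ (W : Scheme.{u}) (k : W ⟶ X), IsOpenImmersion k ∧ π p ∈ Set.range k ∧ P (k ≫ f) := by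
  obtain ⟨_, ⟨US, hUS, rfl⟩, hpS, -⟩ :=
    S.isBasis_affineOpens.exists_subset_of_mem_open (Set.mem_univ (f (π p))) isOpen_univ
  have hpS' : s (f' p) ∈ US := by
    rw [← Scheme.Hom.comp_apply, ← H.w, Scheme.Hom.comp_apply]; exact hpS
  obtain ⟨_, ⟨UX, hUX, rfl⟩, hpX, hX⟩ :=
    X.isBasis_affineOpens.exists_subset_of_mem_open (a := π p) (u := (f ⁻¹ᵁ US : X.Opens)) hpS (f ⁻¹ᵁ US).2
  obtain ⟨_, ⟨UT, hUT, rfl⟩, hpT, hT⟩ :=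
    S'.isBasis_affineOpens.exists_subset_of_mem_open (a := f' p) (u := (s ⁻¹ᵁ US : S'.Opens)) hpS' (s ⁻¹ᵁ US).2
  let A := Γ(S, US)
  let B := Γ(X, UX)
  let A' := Γ(S', UT)
  let : Algebra A B := (f.appLE US UX hX).hom.toAlgebra
  let : Algebra A A' := (s.appLE US UT hT).hom.toAlgebra
  have : Module.Flat A A' := HasRingHomProperty.appLE @Flat s ‹_› ⟨US, hUS⟩ ⟨UT, hUT⟩ hT
  have : Algebra.FinitePresentation A A' := HasRingHomProperty.appLE @LocallyOfFinitePresentation s ‹_› ⟨US, hUS⟩ ⟨UT, hUT⟩ hT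
  have H0 := isPullback_SpecMap_of_isPushout _ _ _ _ (CommRingCat.isPushout_of_isPushout A B A' (A' ⊗[A] B))
  let i1 : Spec (.of B) ⟶ X := hUX.fromSpec
  let i2 : Spec (.of A') ⟶ S' := hUT.fromSpec
  let i3 : Spec (.of A) ⟶ S := hUS.fromSpec
  have : IsOpenImmersion i1 := IsAffineOpen.isOpenImmersion_fromSpec hUX
  have : IsOpenImmersion i2 := IsAffineOpen.isOpenImmersion_fromSpec hUT
  have : IsOpenImmersion i3 := IsAffineOpen.isOpenImmersion_fromSpec hUS
  have r1 : Set.range i1 = UX := hUX.range_fromSpec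
  have r2 : Set.range i2 = UT := hUT.range_fromSpec
  have c1 : Spec.map (CommRingCat.ofHom (algebraMap A B)) ≫ i3 = i1 ≫ f := IsAffineOpen.SpecMap_appLE_fromSpec f hUS hUX hX
  obtain ⟨m, hm, m1, m2, m3⟩ := pbMap H0 H i1 i2 i3
    c1 (IsAffineOpen.SpecMap_appLE_fromSpec s hUS hUT hT)
  obtain ⟨q, rfl⟩ := m3 p (by rw [r1]; exact hpX) (by rw [r2]; exact hpT)
  obtain ⟨b, hb1, hb2⟩ := lemB1 hP A B A' (m ⁻¹ᵁ O) (by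
    refine of_comp_opens _ i2 ?_
    rw [Category.assoc, ← m2, ← Category.assoc, ← morphismRestrict_ι, Category.assoc]
    exact IsZariskiLocalAtSource.comp hO _) q hp
  let j := Spec.map (CommRingCat.ofHom (algebraMap B (Localization.Away b)))
  refine ⟨_, j ≫ i1, inferInstance, ?_, ?_⟩
  · rw [← Scheme.Hom.comp_apply, m1, Scheme.Hom.comp_apply]
    rw [← Scheme.Hom.opensRange_localizationAway (R := .of B) b] at hb1
    obtain ⟨z, hz⟩ := hb1
    refine ⟨z, ?_⟩
    rw [Scheme.Hom.comp_apply]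
    congr 1
  · have : (j ≫ i1) ≫ f = Spec.map (CommRingCat.ofHom (algebraMap A (Localization.Away b))) ≫ i3 := by
      rw [Category.assoc, ← c1, ← Category.assoc]
      congr 1
      rw [IsScalarTower.algebraMap_eq A B (Localization.Away b), CommRingCat.ofHom_comp, Spec.map_comp]
    rw [this]
    exact P.comp_mem _ _ hb2 (IsZariskiLocalAtSource.of_isOpenImmersion _)

lemma glueP [IsZariskiLocalAtSource P] {X S : Scheme.{u}} (f : X ⟶ S) (U : X.Opens)
    (h : ∀ x ∈ U, ∃ (W : Scheme.{u}) (k : W ⟶ X), IsOpenImmersion k ∧ x ∈ Set.range k ∧ P (k ≫ f)) :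
    P (U.ι ≫ f) := by
  choose W k h1 h2 h3 using h
  let V : U → U.toScheme.Opens := fun x => U.ι ⁻¹ᵁ (k x.1 x.2).opensRange
  have hV : iSup V = ⊤ := by
    rw [eq_top_iff]
    intro x _
    rw [TopologicalSpace.Opens.mem_iSup]
    exact ⟨x, h2 x.1 x.2⟩
  refine IsZariskiLocalAtSource.of_iSup_eq_top V hV fun x => ?_
  let r := (V x).ι ≫ U.ι
  have hr : Set.range r ⊆ Set.range (k x.1 x.2) := by
    rintro _ ⟨z, rfl⟩
    exact z.2
  let l := IsOpenImmersion.lift (k x.1 x.2) r hr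
  have hl : l ≫ k x.1 x.2 = r := IsOpenImmersion.lift_fac _ _ _
  have : IsOpenImmersion (l ≫ k x.1 x.2) := by rw [hl]; infer_instance
  have : IsOpenImmersion l := IsOpenImmersion.of_comp l (k x.1 x.2)
  have := IsZariskiLocalAtSource.comp (h3 x.1 x.2) l
  rw [reassoc_of% hl] at this
  simpa [r] using this
end

end helpers

section group
attribute [local simp] prod.lift_fst prod.lift_snd prod.lift_fst_assoc prod.lift_snd_assoc prod.map_fst prod.map_snd prod.map_fst_assoc prod.map_snd_assoc

section cat
variable {C : Type*} [Category C] [HasFiniteProducts C]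
lemma sndSq {G X S : C} (f : X ⟶ S) :
    IsPullback (prod.snd : G ⨯ X ⟶ X) (prod.map (𝟙 G) f) f (prod.snd : G ⨯ S ⟶ S) := by
  refine ⟨⟨by simp⟩, ⟨PullbackCone.IsLimit.mk _ (fun s => prod.lift (s.snd ≫ prod.fst) s.fst) ?_ ?_ ?_⟩⟩
  · intro s; simp
  · intro s
    ext
    · simp
    · simpa using s.condition
  · intro s m h1 h2
    ext
    · simp [← h2]
    · simp [← h1]
end cat

variable {B : Scheme.{u}} {G : GrpOver B}

lemma GScheme.mul_smul (x : GScheme B G) {T : Over B} (g h : T ⟶ G.carrier) (z : T ⟶ x.carrier) :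
    prod.lift (prod.lift g h ≫ G.mul) z ≫ x.act = prod.lift g (prod.lift h z ≫ x.act) ≫ x.act := by
  have := congrArg (fun k => prod.lift (prod.lift g h) z ≫ k) x.mul_act
  simpa [prod.comp_lift_assoc] using this

lemma GScheme.one_smul (x : GScheme B G) {T : Over B} (z : T ⟶ x.carrier) :
    prod.lift (terminal.from T ≫ G.one) z ≫ x.act = z := by
  have := congrArg (fun k => z ≫ k) x.one_act
  simpa [← Category.assoc] using this

lemma GScheme.inv_smul (x : GScheme B G) {T : Over B} (g : T ⟶ G.carrier) (z : T ⟶ x.carrier) :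
    prod.lift (g ≫ G.inv) (prod.lift g z ≫ x.act) ≫ x.act = z := by
  rw [← x.mul_smul]
  have := congrArg (fun k => g ≫ k) G.mul_left_inv
  have h2 : prod.lift (g ≫ G.inv) g ≫ G.mul = terminal.from T ≫ G.one := by
    simpa [← Category.assoc] using this
  rw [h2, x.one_smul]

lemma GScheme.smul_inv (x : GScheme B G) {T : Over B} (g : T ⟶ G.carrier) (z : T ⟶ x.carrier) :
    prod.lift g (prod.lift (g ≫ G.inv) z ≫ x.act) ≫ x.act = z := by
  set w := prod.lift (g ≫ G.inv) z ≫ x.act with hw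
  have h := x.inv_smul g w
  have h3 := x.inv_smul (g ≫ G.inv) (prod.lift g w ≫ x.act)
  have h4 := x.inv_smul (g ≫ G.inv) z
  rw [h] at h3
  rw [← h3]
  exact h4

def GScheme.twist (x : GScheme B G) : G.carrier ⨯ x.carrier ≅ G.carrier ⨯ x.carrier where
  hom := prod.lift prod.fst x.act
  inv := prod.lift prod.fst (prod.lift (prod.fst ≫ G.inv) prod.snd ≫ x.act)
  hom_inv_id := by
    ext1
    · simp
    · have := x.inv_smul (T := G.carrier ⨯ x.carrier) prod.fst prod.snd
      simp only [prod.lift_fst_snd, Category.id_comp] at this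
      simpa [← Category.assoc] using this
  inv_hom_id := by
    ext1
    · simp
    · have := x.smul_inv (T := G.carrier ⨯ x.carrier) prod.fst prod.snd
      simpa [← Category.assoc] using this

lemma GScheme.twist_snd (x : GScheme B G) : x.twist.hom ≫ prod.snd = x.act := by simp [twist]
lemma GScheme.twist_fst (x : GScheme B G) : x.twist.hom ≫ prod.fst = prod.fst := by simp [twist]

lemma actSq {x s : GScheme B G} (f : GHom x s) :
    IsPullback x.act (prod.map (𝟙 _) f.hom) f.hom s.act := by
  refine (sndSq (G := G.carrier) f.hom).of_iso x.twist.symm (Iso.refl _) s.twist.symm (Iso.refl _) ?_ ?_ ?_ ?_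
  · simp [Iso.eq_inv_comp, ← x.twist_snd]
  · simp only [Iso.symm_hom]
    rw [Iso.eq_inv_comp, ← Category.assoc, Iso.comp_inv_eq]
    ext1
    · simp [GScheme.twist]
    · simpa [GScheme.twist] using f.equivariant
  · simp
  · simp [← s.twist_snd]

lemma left_sq {X Y Z W : Over B} {a : X ⟶ Y} {b : X ⟶ Z} {c : Y ⟶ W} {d : Z ⟶ W} (h : IsPullback a b c d) :
    IsPullback a.left b.left c.left d.left := h.map (Over.forget B)

lemma prodSq (X Y : Over B) : IsPullback (prod.fst : X ⨯ Y ⟶ X).left (prod.snd : X ⨯ Y ⟶ Y).left X.hom Y.hom := by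
  refine IsPullback.of_iso_pullback ⟨by simp⟩ (Over.prodLeftIsoPullback X Y) ?_ ?_ <;> simp

lemma snd_flat (hG : G.FlatFinPres) (X : Over B) : Flat (prod.snd : G.carrier ⨯ X ⟶ X).left :=
  MorphismProperty.of_isPullback (P := @Flat) (prodSq _ _) (Flat.of_stalkMap _ hG.1)
lemma snd_lfp (hG : G.FlatFinPres) (X : Over B) : LocallyOfFinitePresentation (prod.snd : G.carrier ⨯ X ⟶ X).left :=
  MorphismProperty.of_isPullback (P := @LocallyOfFinitePresentation) (prodSq _ _) hG.2.1
lemma snd_qc (hG : G.FlatFinPres) (X : Over B) : QuasiCompact (prod.snd : G.carrier ⨯ X ⟶ X).left :=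
  MorphismProperty.of_isPullback (P := @QuasiCompact) (prodSq _ _) hG.2.2.1

lemma act_flat (hG : G.FlatFinPres) (x : GScheme B G) : Flat x.act.left := by
  have := snd_flat hG x.carrier
  have : IsIso x.twist.hom.left := inferInstanceAs (IsIso ((Over.forget B).map x.twist.hom))
  rw [← x.twist_snd, Over.comp_left]
  infer_instance
lemma act_lfp (hG : G.FlatFinPres) (x : GScheme B G) : LocallyOfFinitePresentation x.act.left := by
  have := snd_lfp hG x.carrier
  have : IsIso x.twist.hom.left := inferInstanceAs (IsIso ((Over.forget B).map x.twist.hom))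
  rw [← x.twist_snd, Over.comp_left]
  infer_instance

/-- saturation of an open -/
def sat (hG : G.FlatFinPres) (x : GScheme B G) (V : x.carrier.left.Opens) : x.carrier.left.Opens :=
  ⟨x.act.left '' ((prod.snd : G.carrier ⨯ x.carrier ⟶ _).left ⁻¹ᵁ V : (G.carrier ⨯ x.carrier).left.Opens), by
    have := act_flat hG x
    have := act_lfp hG x
    exact x.act.left.isOpenMap _ (TopologicalSpace.Opens.isOpen _)⟩

lemma le_sat (hG : G.FlatFinPres) (x : GScheme B G) (V : x.carrier.left.Opens) : V ≤ sat hG x V := by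
  intro v hv
  refine ⟨(prod.lift (terminal.from x.carrier ≫ G.one) (𝟙 x.carrier)).left v, ?_, ?_⟩
  · change (prod.snd : G.carrier ⨯ x.carrier ⟶ _).left _ ∈ V
    rw [← Scheme.Hom.comp_apply, ← Over.comp_left, prod.lift_snd]
    exact hv
  · rw [← Scheme.Hom.comp_apply, ← Over.comp_left, x.one_act]
    rfl

lemma sat_inv (hG : G.FlatFinPres) (x : GScheme B G) (V : x.carrier.left.Opens)
    (t : (G.carrier ⨯ x.carrier).left) (ht : (prod.snd : G.carrier ⨯ x.carrier ⟶ _).left t ∈ sat hG x V) :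
    x.act.left t ∈ sat hG x V := by
  obtain ⟨w, hw, hwt⟩ := ht
  obtain ⟨v, hv1, hv2⟩ := Scheme.exists_preimage_of_isPullback
    (left_sq (sndSq (G := G.carrier) x.act)) w t hwt
  let m := (prod.associator G.carrier G.carrier x.carrier).inv ≫ prod.map G.mul (𝟙 x.carrier)
  have h1 : m ≫ x.act = prod.map (𝟙 G.carrier) x.act ≫ x.act := by
    simp only [m, Category.assoc, x.mul_act, Iso.inv_hom_id_assoc]
  have h2 : m ≫ prod.snd = prod.snd ≫ prod.snd := by
    simp [m]
  refine ⟨m.left v, ?_, ?_⟩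
  · change (prod.snd : G.carrier ⨯ x.carrier ⟶ _).left _ ∈ V
    rw [← Scheme.Hom.comp_apply, ← Over.comp_left, h2, Over.comp_left, Scheme.Hom.comp_apply]
    erw [hv1]
    exact hw
  · rw [← Scheme.Hom.comp_apply, ← Over.comp_left, h1, Over.comp_left, Scheme.Hom.comp_apply]
    erw [hv2]

lemma sat_invariant (hG : G.FlatFinPres) (x : GScheme B G) (V : x.carrier.left.Opens) :
    IsInvariantOpen x (sat hG x V) := by
  obtain ⟨U, hU⟩ : ∃ U : x.sch.Opens, U = sat hG x V := ⟨_, rfl⟩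
  rw [← hU]
  have hinv := sat_inv hG x V
  rw [← hU] at hinv
  let q := prod.map (𝟙 G.carrier) (subHom x U.ι) ≫ x.act
  let ql : _ ⟶ x.sch := q.left
  have hr : Set.range ql ⊆ Set.range U.ι := by
    rintro _ ⟨t, rfl⟩
    rw [Scheme.Opens.range_ι]
    change (prod.map (𝟙 G.carrier) (subHom x U.ι) ≫ x.act).left t ∈ U
    rw [Over.comp_left, Scheme.Hom.comp_apply]
    apply hinv
    rw [← Scheme.Hom.comp_apply, ← Over.comp_left, prod.map_snd, Over.comp_left, Scheme.Hom.comp_apply]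
    exact ((prod.snd : G.carrier ⨯ subOver x U.ι ⟶ _).left t).2
  let l : (G.carrier ⨯ subOver x U.ι).left ⟶ U := IsOpenImmersion.lift U.ι ql hr
  have hl : l ≫ U.ι = ql := IsOpenImmersion.lift_fac U.ι ql hr
  refine ⟨Over.homMk l ?_, ?_⟩
  · change _ ≫ U.ι ≫ x.str = _
    rw [← Category.assoc, hl]
    exact Over.w q
  · ext1
    exact hl

lemma sat_compact (hG : G.FlatFinPres) (x : GScheme B G) (V : x.carrier.left.Opens)
    (hV : IsCompact (V : Set x.carrier.left)) : IsCompact (sat hG x V : Set x.carrier.left) := by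
  have := snd_qc hG x.carrier
  exact (Scheme.Hom.isCompact_preimage (prod.snd : G.carrier ⨯ x.carrier ⟶ _).left hV).image x.act.left.continuous

section
variable {P : MorphismProperty Scheme.{u}} (hP : DescAff P) [IsZariskiLocalAtSource P]
  [P.IsStableUnderBaseChange] [P.IsMultiplicative]

lemma sat_P (hP : DescAff P) (hG : G.FlatFinPres) {x s : GScheme B G} (f : GHom x s) (V : x.sch.Opens)
    (hV : P (V.ι ≫ f.sch)) : P (Scheme.Opens.ι (X := x.sch) (sat hG x V) ≫ f.sch) := by
  refine glueP _ _ ?_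
  rintro _ ⟨p, hp, rfl⟩
  have := act_flat hG s
  have := act_lfp hG s
  refine lemB2 hP (left_sq (actSq f)) _ ?_ p hp
  have h1 := isPullback_morphismRestrict (prod.snd : G.carrier ⨯ x.carrier ⟶ _).left V
  exact P.of_isPullback (h1.flip.paste_horiz (left_sq (sndSq (G := G.carrier) f.hom)).flip).flip hV

lemma main1 (hP : DescAff P) (hG : G.FlatFinPres) {x s : GScheme B G} (f : GHom x s) (Y : Set x.sch)
    (h : ∀ y ∈ Y, ∃ U : x.sch.Opens, y ∈ U ∧ P (U.ι ≫ f.sch)) :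
      (∃ U : x.sch.Opens, Y ⊆ (U : Set x.sch) ∧ IsInvariantOpen x U ∧
        P (U.ι ≫ f.sch)) ∧
      (IsCompact Y → ∃ U : x.sch.Opens, Y ⊆ (U : Set x.sch) ∧ IsInvariantOpen x U ∧
        P (U.ι ≫ f.sch) ∧ IsCompact (U : Set x.sch)) := by
  choose U h1 h2 using h
  let V : x.sch.Opens := ⨆ y : Y, U y.1 y.2
  have hYV : Y ⊆ V := fun y hy => (TopologicalSpace.Opens.mem_iSup).2 ⟨⟨y, hy⟩, h1 y hy⟩
  have key : ∀ V0 : x.sch.Opens, V0 ≤ V → P (V0.ι ≫ f.sch) := by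
    intro V0 hV0
    refine glueP _ _ fun z hz => ?_
    obtain ⟨y, hy⟩ := TopologicalSpace.Opens.mem_iSup.1 (hV0 hz)
    exact ⟨_, (U y.1 y.2).ι, inferInstance, by rw [Scheme.Opens.range_ι]; exact hy, h2 _ _⟩
  refine ⟨⟨sat hG x V, hYV.trans (le_sat hG x V), sat_invariant hG x V, sat_P hP hG f V (key V le_rfl)⟩, fun hY => ?_⟩
  obtain ⟨K, hK, ho, hYK, hKV⟩ := PrespectralSpace.exists_isCompact_and_isOpen_between hY V.2 hYV
  let V0 : x.sch.Opens := ⟨K, ho⟩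
  exact ⟨sat hG x V0, hYK.trans (le_sat hG x V0), sat_invariant hG x V0, sat_P hP hG f V0 (key V0 hKV),
    sat_compact hG x V0 hK⟩
end

end group

/-- Let `G` be a flat, finitely presented group scheme over `B`, let
`f : X → S` be a `G`-morphism and `Y ⊆ X` a subset of points.  If `f` is smooth
(resp. étale) at every point of `Y`, then `f` is smooth (resp. étale) on a `G`-invariant
open neighborhood of `Y`, which may be chosen quasi-compact if `Y` is quasi-compact. -/
theorem smooth_on_invariant_open_neighborhood
    {B : Scheme.{u}} {G : GrpOver B} (hG : G.FlatFinPres)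
    {x s : GScheme B G} (f : GHom x s) (Y : Set x.sch) :
    ((∀ y ∈ Y, IsSmoothAt f.sch y) →
      (∃ U : x.sch.Opens, Y ⊆ (U : Set x.sch) ∧ IsInvariantOpen x U ∧
        IsSmooth (U.ι ≫ f.sch)) ∧
      (IsCompact Y → ∃ U : x.sch.Opens, Y ⊆ (U : Set x.sch) ∧ IsInvariantOpen x U ∧
        IsSmooth (U.ι ≫ f.sch) ∧ IsCompact (U : Set x.sch))) ∧
    ((∀ y ∈ Y, IsEtaleAt f.sch y) →
      (∃ U : x.sch.Opens, Y ⊆ (U : Set x.sch) ∧ IsInvariantOpen x U ∧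
        IsEtale (U.ι ≫ f.sch)) ∧
      (IsCompact Y → ∃ U : x.sch.Opens, Y ⊆ (U : Set x.sch) ∧ IsInvariantOpen x U ∧
        IsEtale (U.ι ≫ f.sch) ∧ IsCompact (U : Set x.sch))) := by
  have := zls @Smooth.{u}
  have := zls @Etale.{u}
  have : MorphismProperty.IsMultiplicative @Smooth.{u} := { id_mem := fun _ => inferInstance }
  exact ⟨fun h => main1 (P := @Smooth) descAff_smooth hG f Y h,
    fun h => main1 (P := @Etale) descAff_etale hG f Y h⟩

end EquivariantSix
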